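/- Let A be an m×n matrix with integer entries and let v ∈ ℤⁿ be a nonzero vector with v ≥ 0 componentwise and A·v = 0. Suppose that for every positive integer n and all vectors x, y ∈ ℤⁿ with x ≥ 0, y ≥ 0, A·x = 0, A·y = 0, and x + y = n·v, both x and y are natural-number multiples of v. Then the normalized vector (∑ᵢ vᵢ)⁻¹·v is an extreme point of P = {x ∈ ℝⁿ : x ≥ 0, A·x = 0, ∑ᵢ xᵢ = 1}. -/

import Mathlib

/-- If every integral solution supported in the support of `v` is proportional to `v`,
then the same holds for rational solutions. -/
theorem rat_proportional_of_int_proportional {m n : ℕ} (A : Matrix (Fin m) (Fin n) ℤ)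
    (v : Fin n → ℤ)
    (hv : ∀ z : Fin n → ℤ, A.mulVec z = 0 → (∀ i, v i = 0 → z i = 0) →
      ∀ i j, v j * z i = v i * z j)
    (z : Fin n → ℚ) (hz : ∀ r, ∑ i, (A r i : ℚ) * z i = 0)
    (hsupp : ∀ i, v i = 0 → z i = 0) (i j : Fin n) :
    (v j : ℚ) * z i = v i * z j := by
  obtain ⟨b, hb⟩ := IsLocalization.exist_integer_multiples_of_finite (nonZeroDivisors ℤ) z
  choose w hw using hb
  have hw' : ∀ i, (w i : ℚ) = (b : ℤ) * z i := fun i => by simpa using hw i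
  have hb0 : ((b : ℤ) : ℚ) ≠ 0 := by exact_mod_cast nonZeroDivisors.coe_ne_zero b
  have hprop := hv w ?_ ?_ i j
  · have hq : (v j : ℚ) * w i = v i * w j := by exact_mod_cast hprop
    rw [hw', hw'] at hq
    apply mul_left_cancel₀ hb0
    linear_combination hq
  · ext r
    have hr : ∑ i, (A r i : ℚ) * w i = 0 := by
      simp_rw [hw', mul_left_comm _ ((b : ℤ) : ℚ), ← Finset.mul_sum, hz, mul_zero]
    simp only [Matrix.mulVec, dotProduct, Pi.zero_apply]
    exact_mod_cast hr
  · intro i hi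
    have hq : (w i : ℚ) = 0 := by rw [hw', hsupp i hi, mul_zero]
    exact_mod_cast hq

/-- If every integral solution supported in the support of `v` is proportional to `v`,
then the same holds for real solutions: apply the `ℚ`-linear functionals on `ℝ` coordinatewise. -/
theorem real_proportional_of_int_proportional {m n : ℕ} (A : Matrix (Fin m) (Fin n) ℤ)
    (v : Fin n → ℤ)
    (hv : ∀ z : Fin n → ℤ, A.mulVec z = 0 → (∀ i, v i = 0 → z i = 0) →
      ∀ i j, v j * z i = v i * z j)
    (z : Fin n → ℝ) (hz : ∀ r, ∑ i, (A r i : ℝ) * z i = 0)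
    (hsupp : ∀ i, v i = 0 → z i = 0) (i j : Fin n) :
    (v j : ℝ) * z i = v i * z j := by
  rw [← sub_eq_zero, ← Module.forall_dual_apply_eq_zero_iff ℚ]
  intro f
  have hf : ∀ (a : ℤ) (x : ℝ), f ((a : ℝ) * x) = a * f x := fun a x => by
    rw [← zsmul_eq_mul, map_zsmul, zsmul_eq_mul]
  rw [map_sub, hf, hf, sub_eq_zero]
  refine rat_proportional_of_int_proportional A v hv (fun i => f (z i)) (fun r => ?_)
    (fun i hi => ?_) i j
  · simp_rw [← hf, ← map_sum, hz, map_zero]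
  · rw [hsupp i hi, map_zero]

/-- The decomposition criterion forces integral solutions supported in the support of `v`
to be proportional to `v`. -/
theorem int_proportional_of_integral_criterion {m n : ℕ} (A : Matrix (Fin m) (Fin n) ℤ)
    (v : Fin n → ℤ) (hvnn : ∀ i, 0 ≤ v i) (hvsol : A.mulVec v = 0)
    (h : ∀ k : ℕ, 0 < k → ∀ x y : Fin n → ℤ,
      (∀ i, 0 ≤ x i) → (∀ i, 0 ≤ y i) → A.mulVec x = 0 → A.mulVec y = 0 →
      x + y = (k : ℤ) • v →
      (∃ c : ℕ, x = (c : ℤ) • v) ∧ (∃ c : ℕ, y = (c : ℤ) • v))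
    (z : Fin n → ℤ) (hz : A.mulVec z = 0) (hsupp : ∀ i, v i = 0 → z i = 0) (i j : Fin n) :
    v j * z i = v i * z j := by
  let k : ℕ := ∑ i, (z i).natAbs + 1
  have hk : ∀ i, |z i| ≤ k * v i := fun i => by
    rcases (hvnn i).eq_or_lt with hi | hi
    · simp [hsupp i hi.symm, ← hi]
    · have hle : (z i).natAbs ≤ k :=
        (Finset.single_le_sum (f := fun i => (z i).natAbs) (fun _ _ => Nat.zero_le _)
          (Finset.mem_univ i)).trans (Nat.le_succ _)
      have hle' : |z i| ≤ k := by rw [Int.abs_eq_natAbs]; exact_mod_cast hle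
      nlinarith
  obtain ⟨⟨c, hc⟩, -⟩ := h (2 * k) (by positivity) ((k : ℤ) • v + z) ((k : ℤ) • v - z)
    (fun i => by
      have := neg_le_of_abs_le (hk i)
      simp only [Pi.add_apply, Pi.smul_apply, smul_eq_mul]; linarith)
    (fun i => by
      have := le_of_abs_le (hk i)
      simp only [Pi.sub_apply, Pi.smul_apply, smul_eq_mul]; linarith)
    (by rw [Matrix.mulVec_add, Matrix.mulVec_smul, hvsol, hz]; simp)
    (by rw [Matrix.mulVec_sub, Matrix.mulVec_smul, hvsol, hz]; simp)
    (by push_cast; module)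
  have hz' : ∀ i, z i = (c - k) * v i := fun i => by
    have := congrFun hc i
    simp only [Pi.add_apply, Pi.smul_apply, smul_eq_mul] at this
    linarith
  rw [hz' i, hz' j]
  ring

/-- Integral sufficient criterion for a vertex solution: if every decomposition
`x + y = k • v` of a positive multiple of the nonzero nonnegative integral solution `v`
into nonnegative integral solutions `x, y` consists of natural multiples of `v`,
then the normalization of `v` is an extreme point of the projective solution space. -/
theorem normalized_extremePoint_of_integral_criterion (m n : ℕ)
    (A : Matrix (Fin m) (Fin n) ℤ)
    (v : Fin n → ℤ) (hv0 : v ≠ 0) (hvnn : ∀ i, 0 ≤ v i) (hvsol : A.mulVec v = 0)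
    (h : ∀ k : ℕ, 0 < k → ∀ x y : Fin n → ℤ,
      (∀ i, 0 ≤ x i) → (∀ i, 0 ≤ y i) → A.mulVec x = 0 → A.mulVec y = 0 →
      x + y = (k : ℤ) • v →
      (∃ c : ℕ, x = (c : ℤ) • v) ∧ (∃ c : ℕ, y = (c : ℤ) • v)) :
    ((∑ i, (v i : ℝ))⁻¹ • fun i => (v i : ℝ)) ∈
      ({x : Fin n → ℝ | (∀ i, 0 ≤ x i) ∧
        (A.map (Int.cast : ℤ → ℝ)).mulVec x = 0 ∧ ∑ i, x i = 1}).extremePoints ℝ := by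
  have hsum : 0 < ∑ i, (v i : ℝ) := by
    obtain ⟨i, hi⟩ := Function.ne_iff.mp hv0
    exact Finset.sum_pos' (fun i _ => by exact_mod_cast hvnn i)
      ⟨i, Finset.mem_univ i, by exact_mod_cast (hvnn i).lt_of_ne' hi⟩
  rw [mem_extremePoints_iff_left]
  refine ⟨⟨fun i => ?_, ?_, ?_⟩, ?_⟩
  · have : (0 : ℝ) ≤ v i := by exact_mod_cast hvnn i
    simp only [Pi.smul_apply, smul_eq_mul]
    positivity
  · rw [Matrix.mulVec_smul]
    convert smul_zero _
    ext r
    have := congrFun hvsol r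
    simp only [Matrix.mulVec, dotProduct, Pi.zero_apply, Matrix.map_apply] at this ⊢
    exact_mod_cast this
  · simp only [Pi.smul_apply, smul_eq_mul, ← Finset.mul_sum]
    exact inv_mul_cancel₀ hsum.ne'
  · rintro x ⟨hx0, hxA, hx1⟩ y ⟨hy0, -, -⟩ ⟨a, b, ha, hb, -, hab⟩
    have hsupp : ∀ i, v i = 0 → x i = 0 := fun i hi => by
      have hi' := congrFun hab i
      simp only [Pi.add_apply, Pi.smul_apply, smul_eq_mul, hi, Int.cast_zero, mul_zero] at hi'
      have := mul_nonneg hb.le (hy0 i)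
      have := mul_nonneg ha.le (hx0 i)
      exact (mul_eq_zero.mp (by linarith : a * x i = 0)).resolve_left ha.ne'
    have hprop := real_proportional_of_int_proportional A v
      (int_proportional_of_integral_criterion A v hvnn hvsol h) x (fun r => congrFun hxA r) hsupp
    ext i
    have hi : (∑ j, (v j : ℝ)) * x i = v i := by
      rw [Finset.sum_mul, Finset.sum_congr rfl fun j _ => hprop i j, ← Finset.mul_sum, hx1, mul_one]
    rw [Pi.smul_apply, smul_eq_mul, eq_inv_mul_iff_mul_eq₀ hsum.ne', hi]
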